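/- arXiv:1703.09513 — 2 statements merged into one kernel-verified Lean document; each statement's English description precedes it below -/
import Mathlib

section
/- Upper bound on robustness: let (T, I, R) be a binary dataset with finite sets T and I, let α ∈ [0,1], and let X and Y' be closed itemsets with X ⊊ Y'. Then Rbst_α(X) ≤ 1 − (1−α)^{Δ(X,Y')}, where Δ(X,Y') = |t(X) \ t(Y')|. -/
/-- `d(A) = ⋂_{t ∈ A} δ(t)`, with `d(∅) = I`. -/
def dOp {τ ι : Type*} [Fintype ι] (R : τ → ι → Prop) [∀ t i, Decidable (R t i)]
    (A : Finset τ) : Finset ι :=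
  Finset.univ.filter (fun i => ∀ t ∈ A, R t i)

/-- `t(X) = {t ∈ T : X ⊆ δ(t)}`. -/
def tOp {τ ι : Type*} [Fintype τ] (R : τ → ι → Prop) [∀ t i, Decidable (R t i)]
    (X : Finset ι) : Finset τ :=
  Finset.univ.filter (fun t => ∀ i ∈ X, R t i)

/-- Robustness of `X` in `(T, I, R)`: the sum of weights `α^{|S|}(1-α)^{|T|-|S|}`
over all subdatasets `S ⊆ T` in which `X` is closed, i.e. `d(t(X) ∩ S) = X`. -/
noncomputable def rbst {τ ι : Type*} [Fintype τ] [Fintype ι] [DecidableEq τ] [DecidableEq ι]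
    (R : τ → ι → Prop) [∀ t i, Decidable (R t i)] (α : ℝ) (X : Finset ι) : ℝ :=
  ∑ S ∈ Finset.univ.filter (fun S : Finset τ => dOp R (tOp R X ∩ S) = X),
    α ^ S.card * (1 - α) ^ (Fintype.card τ - S.card)

/-- A random subset of `τ` with inclusion probability `α` avoids `D` with probability
`(1 - α) ^ |D|`. -/
lemma sum_powerset_compl_weight {τ : Type*} [Fintype τ] [DecidableEq τ] (α : ℝ)
    (D : Finset τ) :
    ∑ S ∈ Dᶜ.powerset, α ^ S.card * (1 - α) ^ (Fintype.card τ - S.card) =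
      (1 - α) ^ D.card := by
  have key : ∀ S ∈ Dᶜ.powerset, α ^ S.card * (1 - α) ^ (Fintype.card τ - S.card) =
      α ^ S.card * (1 - α) ^ (Dᶜ.card - S.card) * (1 - α) ^ D.card := by
    intro S hS
    have hle := Finset.card_le_card (Finset.mem_powerset.mp hS)
    have hadd := Finset.card_add_card_compl D
    rw [mul_assoc, ← pow_add]
    congr 2
    omega
  rw [Finset.sum_congr rfl key, ← Finset.sum_mul, Finset.sum_pow_mul_eq_add_pow]
  simp

lemma mem_dOp {τ ι : Type*} [Fintype ι] (R : τ → ι → Prop) [∀ t i, Decidable (R t i)]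
    {A : Finset τ} {i : ι} : i ∈ dOp R A ↔ ∀ t ∈ A, R t i := by
  simp [dOp]

/-- If `X` is closed in the subdataset `S` and `X ⊊ Y`, then `S` meets `t(X) \ t(Y)`. -/
lemma not_subset_compl_of_closed {τ ι : Type*} [Fintype τ] [Fintype ι] [DecidableEq τ]
    (R : τ → ι → Prop) [∀ t i, Decidable (R t i)] {X Y : Finset ι} (hss : X ⊂ Y)
    {S : Finset τ} (hS : dOp R (tOp R X ∩ S) = X) : ¬ S ⊆ (tOp R X \ tOp R Y)ᶜ := by
  intro hsub
  refine hss.2 fun i hi => ?_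
  rw [← hS, mem_dOp]
  intro t ht
  obtain ⟨htX, htS⟩ := Finset.mem_inter.mp ht
  have htY : t ∈ tOp R Y := by
    by_contra h
    exact Finset.mem_compl.mp (hsub htS) (Finset.mem_sdiff.mpr ⟨htX, h⟩)
  exact (Finset.mem_filter.mp htY).2 i hi

/-- Upper bound on robustness: for `α ∈ [0,1]`, if `X` and `Y'` are closed
itemsets with `X ⊊ Y'`, then `Rbst_α(X) ≤ 1 - (1-α)^{Δ(X,Y')}` where
`Δ(X,Y') = |t(X) \ t(Y')|`. -/
theorem rbst_upper_bound
    {τ ι : Type*} [Fintype τ] [Fintype ι] [DecidableEq τ] [DecidableEq ι]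
    (R : τ → ι → Prop) [∀ t i, Decidable (R t i)]
    (α : ℝ) (hα0 : 0 ≤ α) (hα1 : α ≤ 1)
    (X Y' : Finset ι)
    (hX : dOp R (tOp R X) = X) (hY' : dOp R (tOp R Y') = Y') (hss : X ⊂ Y') :
    rbst R α X ≤ 1 - (1 - α) ^ ((tOp R X \ tOp R Y').card) := by
  rw [le_sub_iff_add_le, ← sum_powerset_compl_weight, rbst, ← Finset.sum_union]
  · calc _ ≤ ∑ S : Finset τ, α ^ S.card * (1 - α) ^ (Fintype.card τ - S.card) :=
          Finset.sum_le_sum_of_subset_of_nonneg (Finset.subset_univ _) fun S _ _ =>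
            mul_nonneg (pow_nonneg hα0 _) (pow_nonneg (sub_nonneg.mpr hα1) _)
      _ = 1 := by simpa using sum_powerset_compl_weight α (∅ : Finset τ)
  · exact Finset.disjoint_left.mpr fun S hS hS' =>
      not_subset_compl_of_closed R hss (Finset.mem_filter.mp hS).2 (Finset.mem_powerset.mp hS')
end

section
/- Lower bound on robustness: let (T, I, R) be a binary dataset with finite sets T and I, let α ∈ [0,1], and let X be a closed itemset. Then Rbst_α(X) ≥ 1 − Σ_{Y'} (1−α)^{Δ(X,Y')}, where the sum ranges over all immediate closed supersets Y' of X and Δ(X,Y') = |t(X) \ t(Y')|. -/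
open scoped Classical

/-- `Y'` is an immediate closed superset of `X`: `Y'` is closed, `X ⊊ Y'`, and
there is no closed itemset strictly between them. -/
def ImmediateClosedSuperset {τ ι : Type*} [Fintype τ] [Fintype ι]
    (R : τ → ι → Prop) [∀ t i, Decidable (R t i)] (X Y' : Finset ι) : Prop :=
  dOp R (tOp R Y') = Y' ∧ X ⊂ Y' ∧ ¬ ∃ Z, dOp R (tOp R Z) = Z ∧ X ⊂ Z ∧ Z ⊂ Y'

/-- The weights of the subsets of `T` that avoid `D` add up to `(1 - α) ^ |D|`. -/
theorem sum_weight_disjoint {τ : Type*} [Fintype τ] [DecidableEq τ] (α : ℝ) (D : Finset τ) :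
    ∑ S ∈ Finset.univ.filter (fun S : Finset τ => Disjoint S D),
      α ^ S.card * (1 - α) ^ (Fintype.card τ - S.card) = (1 - α) ^ D.card := by
  have hfilter : Finset.univ.filter (fun S : Finset τ => Disjoint S D) = Dᶜ.powerset := by
    ext S
    simp [Finset.subset_compl_iff_disjoint_right]
  have hcard : D.card + Dᶜ.card = Fintype.card τ := Finset.card_add_card_compl D
  calc _ = ∑ S ∈ Dᶜ.powerset,
        (1 - α) ^ D.card * (α ^ S.card * (1 - α) ^ (Dᶜ.card - S.card)) := by
        rw [hfilter]
        refine Finset.sum_congr rfl fun S hS => ?_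
        have hle := Finset.card_le_card (Finset.mem_powerset.1 hS)
        rw [show Fintype.card τ - S.card = D.card + (Dᶜ.card - S.card) by omega, pow_add]
        ring
    _ = (1 - α) ^ D.card := by
        rw [← Finset.mul_sum, Finset.sum_pow_mul_eq_add_pow]
        simp

/-- The Galois connection between itemsets and tidsets. -/
theorem subset_dOp_iff_subset_tOp {τ ι : Type*} [Fintype τ] [Fintype ι]
    (R : τ → ι → Prop) [∀ t i, Decidable (R t i)] (X : Finset ι) (A : Finset τ) :
    X ⊆ dOp R A ↔ A ⊆ tOp R X := by
  simp only [Finset.subset_iff, dOp, tOp, Finset.mem_filter, Finset.mem_univ, true_and]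
  exact ⟨fun h t ht i hi => h hi t ht, fun h i hi t ht => h ht i hi⟩

theorem dOp_tOp_dOp {τ ι : Type*} [Fintype τ] [Fintype ι]
    (R : τ → ι → Prop) [∀ t i, Decidable (R t i)] (A : Finset τ) :
    dOp R (tOp R (dOp R A)) = dOp R A := by
  refine Finset.Subset.antisymm ?_ ((subset_dOp_iff_subset_tOp R _ _).2 subset_rfl)
  rw [subset_dOp_iff_subset_tOp]
  exact ((subset_dOp_iff_subset_tOp R _ _).1 subset_rfl).trans
    ((subset_dOp_iff_subset_tOp R _ _).1 subset_rfl)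

theorem exists_immediateClosedSuperset_subset {τ ι : Type*} [Fintype τ] [Fintype ι]
    (R : τ → ι → Prop) [∀ t i, Decidable (R t i)] {X Z : Finset ι}
    (hZ : dOp R (tOp R Z) = Z) (hXZ : X ⊂ Z) :
    ∃ Y, ImmediateClosedSuperset R X Y ∧ Y ⊆ Z := by
  obtain ⟨Y, hYZ, hY⟩ := (Set.toFinite {W | dOp R (tOp R W) = W ∧ X ⊂ W}).exists_le_minimal
    (show Z ∈ {W | dOp R (tOp R W) = W ∧ X ⊂ W} from ⟨hZ, hXZ⟩)
  refine ⟨Y, ⟨hY.prop.1, hY.prop.2, ?_⟩, hYZ⟩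
  rintro ⟨W, hW, hXW, hWY⟩
  exact hWY.2 (hY.le_of_le ⟨hW, hXW⟩ hWY.1)

/-- If `X` is not closed in the subdataset `S`, then `S` avoids `t(X) \ t(Y)` for some immediate
closed superset `Y` of `X`. -/
theorem exists_immediateClosedSuperset_disjoint {τ ι : Type*} [Fintype τ] [Fintype ι]
    [DecidableEq τ] (R : τ → ι → Prop) [∀ t i, Decidable (R t i)] {X : Finset ι} {S : Finset τ}
    (hS : dOp R (tOp R X ∩ S) ≠ X) :
    ∃ Y, ImmediateClosedSuperset R X Y ∧ Disjoint S (tOp R X \ tOp R Y) := by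
  have hsub : X ⊆ dOp R (tOp R X ∩ S) :=
    (subset_dOp_iff_subset_tOp R _ _).2 Finset.inter_subset_left
  obtain ⟨Y, hY, hYS⟩ := exists_immediateClosedSuperset_subset R (dOp_tOp_dOp R (tOp R X ∩ S))
    (hsub.ssubset_of_ne hS.symm)
  refine ⟨Y, hY, Finset.disjoint_left.2 fun t ht htXY => ?_⟩
  obtain ⟨htX, htY⟩ := Finset.mem_sdiff.1 htXY
  exact htY ((subset_dOp_iff_subset_tOp R _ _).1 hYS (Finset.mem_inter.2 ⟨htX, ht⟩))

/-- Lower bound on robustness: for `α ∈ [0,1]` and a closed itemset `X`,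
`Rbst_α(X) ≥ 1 - Σ_{Y'} (1-α)^{Δ(X,Y')}`, the sum ranging over all immediate
closed supersets `Y'` of `X`, where `Δ(X,Y') = |t(X) \ t(Y')|`. -/
theorem rbst_lower_bound
    {τ ι : Type*} [Fintype τ] [Fintype ι] [DecidableEq τ] [DecidableEq ι]
    (R : τ → ι → Prop) [∀ t i, Decidable (R t i)]
    (α : ℝ) (hα0 : 0 ≤ α) (hα1 : α ≤ 1)
    (X : Finset ι) (hX : dOp R (tOp R X) = X) :
    rbst R α X ≥
      1 - ∑ Y' ∈ Finset.univ.filter (fun Y' : Finset ι => ImmediateClosedSuperset R X Y'),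
            (1 - α) ^ ((tOp R X \ tOp R Y').card) := by
  set w : Finset τ → ℝ := fun S => α ^ S.card * (1 - α) ^ (Fintype.card τ - S.card)
  have hw0 (S : Finset τ) : 0 ≤ w S :=
    mul_nonneg (pow_nonneg hα0 _) (pow_nonneg (sub_nonneg.2 hα1) _)
  have htotal : ∑ S, w S = 1 := by simpa using sum_weight_disjoint α (∅ : Finset τ)
  have hsplit : rbst R α X
      + ∑ S ∈ Finset.univ.filter (fun S : Finset τ => ¬ dOp R (tOp R X ∩ S) = X), w S = 1 := by
    rw [← htotal]
    exact Finset.sum_filter_add_sum_filter_not _ _ _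
  have hbad : ∑ S ∈ Finset.univ.filter (fun S : Finset τ => ¬ dOp R (tOp R X ∩ S) = X), w S
      ≤ ∑ Y' ∈ Finset.univ.filter (fun Y' : Finset ι => ImmediateClosedSuperset R X Y'),
          (1 - α) ^ ((tOp R X \ tOp R Y').card) := by
    simp_rw [← sum_weight_disjoint α, Finset.sum_filter (fun S : Finset τ => Disjoint S _)]
    rw [Finset.sum_comm, Finset.sum_filter]
    refine Finset.sum_le_sum fun S _ => ?_
    have hterm (Y : Finset ι) : 0 ≤ if Disjoint S (tOp R X \ tOp R Y) then w S else 0 := by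
      split_ifs
      exacts [hw0 S, le_rfl]
    split_ifs with hS
    · exact Finset.sum_nonneg fun Y _ => hterm Y
    · obtain ⟨Y, hY, hdisj⟩ := exists_immediateClosedSuperset_disjoint R hS
      have hle := Finset.single_le_sum (fun Y _ => hterm Y)
        (Finset.mem_filter.2 ⟨Finset.mem_univ Y, hY⟩)
      rwa [if_pos hdisj] at hle
  linarith
end
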